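/- arXiv:2001.01419 — 2 statements merged into one kernel-verified Lean document; each statement's English description precedes it below -/
import Mathlib

section
/- Let G be a triangle-free simple graph on n vertices with m edges, and let k be a positive integer with τ(G) ≥ k. Then rmc_k(G) = m − k(n − 2). -/
open SimpleGraph

/-- A walk is monochromatic with color `col` under the edge-coloring `c`. -/
def SimpleGraph.Walk.IsMonochromatic {V : Type*} {G : SimpleGraph V} (c : Sym2 V → ℕ)
    {u v : V} (W : G.Walk u v) (col : ℕ) : Prop :=
  ∀ e ∈ W.edges, c e = col

/-- `c` is a rainbow monochromatic `k`-edge-connection coloring of `G`: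
every two distinct vertices are joined by `k` pairwise edge-disjoint monochromatic
paths with pairwise distinct colors. -/
def SimpleGraph.IsRMCColoring {V : Type*} (G : SimpleGraph V) (k : ℕ) (c : Sym2 V → ℕ) : Prop :=
  ∀ u v : V, u ≠ v → ∃ (P : Fin k → G.Walk u v) (col : Fin k → ℕ),
    (∀ i, (P i).IsPath) ∧
    (∀ i, (P i).IsMonochromatic c (col i)) ∧
    (∀ i j, i ≠ j → ∀ e, e ∈ (P i).edges → e ∉ (P j).edges) ∧
    Function.Injective col

/-- The number of colors used by `c` on the edges of `G`. -/
noncomputable def SimpleGraph.colorsUsed {V : Type*} (G : SimpleGraph V) (c : Sym2 V → ℕ) : ℕ :=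
  (c '' G.edgeSet).ncard

/-- `rmc_k(G)`: the maximum number of colors in an RMC_k-coloring of `G` (0 if none exists). -/
noncomputable def SimpleGraph.rmc {V : Type*} (G : SimpleGraph V) (k : ℕ) : ℕ :=
  sSup {t | ∃ c : Sym2 V → ℕ, G.IsRMCColoring k c ∧ G.colorsUsed c = t}

/-- `τ(G) ≥ k`: `G` has `k` pairwise edge-disjoint spanning trees
(Nash-Williams–Tutte). -/
def SimpleGraph.TauGE {V : Type*} (G : SimpleGraph V) (k : ℕ) : Prop :=
  ∃ T : Fin k → SimpleGraph V, (∀ i, T i ≤ G) ∧ (∀ i, (T i).IsTree) ∧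
    ∀ i j, i ≠ j → Disjoint (T i).edgeSet (T j).edgeSet


/-- The vertices reachable from a root, together with an independent set of non-isolated vertices
that are not reachable from the root, are at most one more than the edges. -/
theorem SimpleGraph.card_reachable_add_card_le {V : Type*} [Fintype V] (H : SimpleGraph V) (v : V)
    (R Z : Finset V) (E : Finset (Sym2 V)) (hE : ∀ e ∈ H.edgeSet, e ∈ E)
    (hR : ∀ u ∈ R, u ≠ v ∧ H.Reachable v u)
    (hZ : ∀ u ∈ Z, ¬ H.Reachable v u ∧ ∃ w, H.Adj u w)
    (hind : ∀ x ∈ Z, ∀ y ∈ Z, ¬ H.Adj x y) :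
    R.card + Z.card ≤ E.card := by
  classical
  have hdisj : Disjoint R Z := Finset.disjoint_left.2 fun u hu hu' => (hZ u hu').1 (hR u hu).2
  have hpar : ∀ u, ∃ w, (u ∈ R → H.Adj u w ∧ H.dist w v < H.dist u v) ∧ (u ∈ Z → H.Adj u w) := by
    intro u
    by_cases hu : u ∈ R
    · obtain ⟨W, hW⟩ := (hR u hu).2.symm.exists_walk_length_eq_dist
      cases W with
      | nil => exact absurd rfl (hR _ hu).1
      | cons h p =>
        refine ⟨_, fun _ => ⟨h, ?_⟩, fun _ => h⟩
        have := SimpleGraph.dist_le p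
        rw [SimpleGraph.Walk.length_cons] at hW
        omega
    · by_cases hu' : u ∈ Z
      · obtain ⟨w, hw⟩ := (hZ u hu').2
        exact ⟨w, fun h => absurd h hu, fun _ => hw⟩
      · exact ⟨u, fun h => absurd h hu, fun h => absurd h hu'⟩
  choose par hp1 hp2 using hpar
  have hadj : ∀ u ∈ R ∪ Z, H.Adj u (par u) := fun u hu =>
    (Finset.mem_union.1 hu).elim (fun h => (hp1 u h).1) (hp2 u)
  rw [← Finset.card_union_of_disjoint hdisj]
  refine Finset.card_le_card_of_injOn (fun u => s(u, par u))
    (fun u hu => hE _ (hadj u hu)) ?_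
  intro a ha b hb hab
  rcases Sym2.eq_iff.1 hab with h | ⟨h1, h2⟩
  · exact h.1
  · have hA := hadj a ha
    rw [h2] at hA
    rcases Finset.mem_union.1 ha with ha | ha <;> rcases Finset.mem_union.1 hb with hb | hb
    · have e1 := (hp1 a ha).2
      have e2 := (hp1 b hb).2
      rw [h2] at e1
      rw [← h1] at e2
      omega
    · exact absurd ((hR a ha).2.trans hA.reachable) (hZ b hb).1
    · exact absurd ((hR b hb).2.trans hA.symm.reachable) (hZ a ha).1
    · exact absurd hA (hind a ha b hb)

/-- A choice, constant on the components of `H`, of representatives in `Y`. -/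
theorem SimpleGraph.exists_representative {V : Type*} (H : SimpleGraph V) (Y : Finset V) :
    ∃ g : V → V, (∀ x ∈ Y, g x ∈ Y ∧ H.Reachable x (g x)) ∧
      ∀ x y, H.Reachable x y → g x = g y := by
  classical
  refine ⟨fun x => @Classical.epsilon V ⟨x⟩ (fun y => y ∈ Y ∧ H.Reachable x y), ?_, ?_⟩
  · intro x hx
    have : ∃ y, y ∈ Y ∧ H.Reachable x y := ⟨x, hx, .refl x⟩
    exact Classical.epsilon_spec this
  · intro x y h
    have : (fun z => z ∈ Y ∧ H.Reachable x z) = fun z => z ∈ Y ∧ H.Reachable y z := by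
      funext z
      exact propext ⟨fun hz => ⟨hz.1, h.symm.trans hz.2⟩, fun hz => ⟨hz.1, h.trans hz.2⟩⟩
    simp only [this]

/-- If stars centred at representatives `g c x`, for `x ∈ D c`, connect `Y`, then the sets `D c`
have total size at least `|Y| - 1`. -/
theorem Finset.card_le_sum_card_add_one {V : Type*} (Y : Finset V) (C : Finset ℕ)
    (D : ℕ → Finset V) (g : ℕ → V → V) (hY : Y.Nonempty)
    (hconn : ∀ F : SimpleGraph Y,
      (∀ x y : Y, ∀ c ∈ C, x.1 ∈ D c → g c x.1 = y.1 → F.Reachable x y) → F.Preconnected) :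
    Y.card ≤ ∑ c ∈ C, (D c).card + 1 := by
  classical
  let F : SimpleGraph Y := SimpleGraph.fromRel (fun x y => ∃ c ∈ C, x.1 ∈ D c ∧ g c x.1 = y.1)
  have hF : F.Connected := by
    have : Nonempty Y := hY.to_subtype
    refine ⟨hconn F ?_⟩
    intro x y c hc hx hxy
    by_cases h : x = y
    · exact h ▸ .refl x
    · exact SimpleGraph.Adj.reachable ((SimpleGraph.fromRel_adj _ _ _).2 ⟨h, .inl ⟨c, hc, hx, hxy⟩⟩)
  have h1 := hF.card_vert_le_card_edgeSet_add_one
  have h2 : Nat.card F.edgeSet ≤ ∑ c ∈ C, (D c).card := by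
    rw [Nat.card_eq_fintype_card, ← SimpleGraph.edgeFinset_card,
      ← Finset.card_image_of_injective _ (Sym2.map.injective Subtype.val_injective)]
    refine le_trans (Finset.card_le_card
      (t := C.biUnion fun c => (D c).image fun x => s(x, g c x)) ?_)
      (Finset.card_biUnion_le.trans (Finset.sum_le_sum fun c _ => Finset.card_image_le))
    intro e he
    obtain ⟨f, hf, rfl⟩ := Finset.mem_image.1 he
    induction f using Sym2.ind with
    | _ x y =>
      rw [SimpleGraph.mem_edgeFinset, SimpleGraph.mem_edgeSet] at hf
      simp only [Finset.mem_biUnion, Finset.mem_image, Sym2.map_mk]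
      rcases ((SimpleGraph.fromRel_adj _ _ _).1 hf).2 with ⟨c, hc, hx, hxy⟩ | ⟨c, hc, hx, hxy⟩
      · exact ⟨c, hc, x, hx, by simp [hxy]⟩
      · exact ⟨c, hc, y, hx, by simp [hxy, Sym2.eq_swap]⟩
  simp only [Nat.card_eq_fintype_card, Fintype.card_coe] at h1 h2
  omega

/-- The spanning subgraph formed by the edges of one color. -/
def SimpleGraph.colorClass {V : Type*} (G : SimpleGraph V) (c : Sym2 V → ℕ) (col : ℕ) :
    SimpleGraph V where
  Adj u w := G.Adj u w ∧ c s(u, w) = col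
  symm := ⟨fun u w h => ⟨h.1.symm, by rw [Sym2.eq_swap]; exact h.2⟩⟩
  loopless := ⟨fun u h => G.loopless.irrefl u h.1⟩

theorem SimpleGraph.Walk.IsMonochromatic.reachable {V : Type*} {G : SimpleGraph V}
    {c : Sym2 V → ℕ} {u v : V} {W : G.Walk u v} {col : ℕ} (h : W.IsMonochromatic c col) :
    (G.colorClass c col).Reachable u v := by
  induction W with
  | nil => exact .refl _
  | cons hadj p ih =>
    have h1 : (G.colorClass c col).Adj _ _ := ⟨hadj, h _ (by simp)⟩
    exact h1.reachable.trans (ih fun e he => h e (by simp [he]))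

theorem SimpleGraph.Reachable.exists_adj {V : Type*} {H : SimpleGraph V} {u v : V}
    (h : H.Reachable u v) (hne : u ≠ v) : ∃ w, H.Adj u w := by
  obtain ⟨W⟩ := h
  cases W with
  | nil => exact absurd rfl hne
  | cons hadj _ => exact ⟨_, hadj⟩

/-- Two distinct vertices are connected in at least `k` color classes. -/
theorem SimpleGraph.IsRMCColoring.le_card_filter {V : Type*} {G : SimpleGraph V} {k : ℕ}
    {c : Sym2 V → ℕ} (hc : G.IsRMCColoring k c) (C : Finset ℕ) (hC : ∀ e ∈ G.edgeSet, c e ∈ C)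
    {u v : V} (huv : u ≠ v) [DecidablePred fun col => (G.colorClass c col).Reachable u v] :
    k ≤ (C.filter fun col => (G.colorClass c col).Reachable u v).card := by
  obtain ⟨P, col, -, hmono, -, hinj⟩ := hc u v huv
  rw [← Fintype.card_fin k, ← Finset.card_univ]
  refine Finset.card_le_card_of_injOn col (fun i _ => ?_) hinj.injOn
  have hr := (hmono i).reachable
  obtain ⟨w, hw⟩ := hr.exists_adj huv
  exact Finset.mem_coe.2 (Finset.mem_filter.2 ⟨hw.2 ▸ hC _ hw.1, hr⟩)

/-- The upper bound on the number of colors in a triangle-free graph. -/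
theorem SimpleGraph.IsRMCColoring.colorsUsed_add_le {V : Type*} [Fintype V] {G : SimpleGraph V}
    {k : ℕ} (hk : 1 ≤ k) (htri : G.CliqueFree 3) {c : Sym2 V → ℕ} (hc : G.IsRMCColoring k c)
    (v : V) (hn : 2 ≤ Fintype.card V) :
    G.colorsUsed c + k * (Fintype.card V - 2) ≤ G.edgeSet.ncard := by
  classical
  set E := G.edgeFinset with hE
  set C := E.image c with hCdef
  have hC : ∀ e ∈ G.edgeSet, c e ∈ C := fun e he =>
    Finset.mem_image_of_mem c (SimpleGraph.mem_edgeFinset.2 he)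
  have hcolors : G.colorsUsed c = C.card := by
    rw [SimpleGraph.colorsUsed, ← SimpleGraph.coe_edgeFinset, ← Finset.coe_image,
      Set.ncard_coe_finset]
  have hm : G.edgeSet.ncard = E.card := by
    rw [← SimpleGraph.coe_edgeFinset, Set.ncard_coe_finset]
  let H := G.colorClass c
  let M : V → Finset ℕ := fun u => C.filter fun col => (H col).Reachable v u
  have hM : ∀ u, u ≠ v → k ≤ (M u).card := fun u hu => hc.le_card_filter C hC hu.symm
  let A := (G.neighborFinset v).image fun w => c s(v, w)
  have hAC : A ⊆ C := by
    intro a ha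
    obtain ⟨w, hw, rfl⟩ := Finset.mem_image.1 ha
    exact hC _ ((SimpleGraph.mem_neighborFinset _ _ _).1 hw)
  have hMA : ∀ u, u ≠ v → M u ⊆ A := by
    intro u hu col hcol
    obtain ⟨w, hw⟩ := (Finset.mem_filter.1 hcol).2.exists_adj hu.symm
    exact Finset.mem_image.2 ⟨w, (SimpleGraph.mem_neighborFinset _ _ _).2 hw.1, hw.2⟩
  obtain ⟨N, hNsub, hNinj, hNA⟩ := Finset.exists_subset_injOn_image_eq_of_surjOn
    (f := fun w => c s(v, w)) (G.neighborFinset v : Set V) A (by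
      intro a ha
      simpa [A] using ha)
  have hNcard : N.card = A.card := by rw [← hNA, Finset.card_image_of_injOn hNinj]
  have hNadj : ∀ x ∈ N, G.Adj v x := fun x hx =>
    (SimpleGraph.mem_neighborFinset _ _ _).1 (hNsub hx)
  have hind : ∀ x ∈ N, ∀ y ∈ N, ¬ G.Adj x y := by
    intro x hx y hy hxy
    exact htri {v, x, y} (SimpleGraph.is3Clique_triple_iff.2 ⟨hNadj x hx, hNadj y hy, hxy⟩)
  have hNM : ∀ x ∈ N, c s(v, x) ∈ M x := fun x hx =>
    Finset.mem_filter.2 ⟨hC _ (hNadj x hx), SimpleGraph.Adj.reachable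
      (show (H (c s(v, x))).Adj v x from ⟨hNadj x hx, rfl⟩)⟩
  let Y := N.filter fun x => (M x).card = k
  have hYN : Y ⊆ N := Finset.filter_subset _ _
  choose g hg1 hg2 using fun col => (H col).exists_representative Y
  let D : ℕ → Finset V := fun col => Y.filter fun x => ¬ (H col).Reachable v x ∧ g col x ≠ x
  -- The stars between vertices of `Y` and their representatives connect `Y` when `k < |Y|`.
  have hYD : Y.card ≤ ∑ col ∈ C, (D col).card + k := by
    by_cases hYk : Y.card ≤ k
    · omega
    refine (Finset.card_le_sum_card_add_one Y C D g (Finset.card_pos.1 (by omega)) ?_).trans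
      (by omega)
    intro F hF
    have hdiff : ∀ x y : Y, M x ≠ M y → F.Reachable x y := by
      intro x y hxy
      have hxyne : x.1 ≠ y.1 := fun h => hxy (by rw [h])
      have hex : ∃ col ∈ C, (H col).Reachable x y ∧ ¬ (H col).Reachable v x := by
        by_contra! hcon
        apply hxy
        have hl := hc.le_card_filter C hC hxyne
        have hsx : (C.filter fun col => (H col).Reachable x y) ⊆ M x := fun col h =>
          Finset.mem_filter.2 ⟨(Finset.mem_filter.1 h).1,
            hcon col (Finset.mem_filter.1 h).1 (Finset.mem_filter.1 h).2⟩
        have hsy : (C.filter fun col => (H col).Reachable x y) ⊆ M y := fun col h =>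
          Finset.mem_filter.2 ⟨(Finset.mem_filter.1 h).1,
            (hcon col (Finset.mem_filter.1 h).1 (Finset.mem_filter.1 h).2).trans
              (Finset.mem_filter.1 h).2⟩
        rw [← Finset.eq_of_subset_of_card_le hsx ((Finset.mem_filter.1 x.2).2.trans_le hl),
          ← Finset.eq_of_subset_of_card_le hsy ((Finset.mem_filter.1 y.2).2.trans_le hl)]
      obtain ⟨col, hcol, hr, hv⟩ := hex
      have hstep : ∀ z : Y, ¬ (H col).Reachable v z →
          F.Reachable z ⟨g col z, (hg1 col z z.2).1⟩ := by
        intro z hz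
        by_cases h : g col z = z
        · simp only [h]; exact .refl z
        · exact hF _ _ col hcol (Finset.mem_filter.2 ⟨z.2, hz, h⟩) rfl
      have h1 := hstep x hv
      have h2 := hstep y fun h => hv (h.trans hr.symm)
      simp only [hg2 col x y hr] at h1
      exact h1.trans h2.symm
    intro x y
    by_cases hxy : M x = M y
    · have : ∃ z : Y, M z ≠ M x := by
        by_contra! hcon
        apply hYk
        rw [← (Finset.mem_filter.1 x.2).2]
        refine Finset.card_le_card_of_injOn (fun w => c s(v, w)) (fun z hz => ?_)
          (hNinj.mono (by exact_mod_cast hYN))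
        rw [← hcon ⟨z, hz⟩]
        exact hNM z (hYN hz)
      obtain ⟨z, hz⟩ := this
      exact (hdiff x z hz.symm).trans (hdiff z y (hxy ▸ hz))
    · exact hdiff x y hxy
  let R : ℕ → Finset V := fun col => (Finset.univ.erase v).filter fun u => (H col).Reachable v u
  let Ec : ℕ → Finset (Sym2 V) := fun col => E.filter fun e => c e = col
  have hEc : ∀ col, ∀ e ∈ (H col).edgeSet, e ∈ Ec col := by
    intro col e
    induction e using Sym2.ind with
    | _ a b =>
      intro h
      exact Finset.mem_filter.2 ⟨SimpleGraph.mem_edgeFinset.2 h.1, h.2⟩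
  have hbound : ∀ col (Z : Finset V), Z ⊆ Y →
      (∀ u ∈ Z, ¬ (H col).Reachable v u ∧ ∃ w, (H col).Adj u w) →
      (R col).card + Z.card ≤ (Ec col).card := by
    intro col Z hZY hZ
    refine (H col).card_reachable_add_card_le v _ Z _ (hEc col) (fun u hu => ?_) hZ
      fun x hx y hy h => hind x (hYN (hZY hx)) y (hYN (hZY hy)) h.1
    have := Finset.mem_filter.1 hu
    exact ⟨Finset.ne_of_mem_erase this.1, this.2⟩
  have hD : ∀ col, ∀ u ∈ D col, ¬ (H col).Reachable v u ∧ ∃ w, (H col).Adj u w := by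
    intro col u hu
    obtain ⟨huY, h1, h2⟩ := Finset.mem_filter.1 hu
    exact ⟨h1, (hg1 col u huY).2.exists_adj h2.symm⟩
  have hcol : ∀ col ∈ C, (R col).card + (D col).card + (if col ∈ A then 0 else 1) ≤
      (Ec col).card := by
    intro col hcolC
    split_ifs with hA
    · exact hbound col (D col) (Finset.filter_subset _ _) (hD col)
    · have hR0 : R col = ∅ := by
        refine Finset.filter_eq_empty_iff.2 fun u hu hr => hA ?_
        exact hMA u (Finset.ne_of_mem_erase hu) (Finset.mem_filter.2 ⟨hcolC, hr⟩)
      rw [hR0, Finset.card_empty, zero_add]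
      rcases (D col).eq_empty_or_nonempty with h0 | ⟨x, hx⟩
      · rw [h0, Finset.card_empty, zero_add]
        obtain ⟨e, he, hec⟩ := Finset.mem_image.1 hcolC
        exact Finset.card_pos.2 ⟨e, Finset.mem_filter.2 ⟨he, hec⟩⟩
      · obtain ⟨hxY, h1, h2⟩ := Finset.mem_filter.1 hx
        obtain ⟨hgY, hgr⟩ := hg1 col x hxY
        have hnot : g col x ∉ D col := fun h =>
          (Finset.mem_filter.1 h).2.2 (hg2 col _ _ hgr).symm
        rw [← Finset.card_insert_of_notMem hnot]
        refine (Nat.le_add_left _ _).trans (hbound col _ (Finset.insert_subset hgY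
          (Finset.filter_subset _ _)) fun u hu => ?_)
        rcases Finset.mem_insert.1 hu with rfl | hu
        · exact ⟨fun h => h1 (h.trans hgr.symm), hgr.symm.exists_adj h2⟩
        · exact hD col u hu
  have hsumE : ∑ col ∈ C, (Ec col).card = E.card :=
    (Finset.card_eq_sum_card_fiberwise fun e he =>
      Finset.mem_coe.2 (Finset.mem_image_of_mem c he)).symm
  have hsumA : ∑ col ∈ C, (if col ∈ A then 0 else 1) = C.card - A.card := by
    rw [← Finset.card_sdiff_of_subset hAC, Finset.card_eq_sum_ones, ← Finset.filter_notMem_eq_sdiff,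
      Finset.sum_filter]
    exact Finset.sum_congr rfl fun x _ => by split_ifs <;> simp_all
  have hsumR : ∑ col ∈ C, (R col).card = ∑ u ∈ Finset.univ.erase v, (M u).card :=
    Finset.sum_card_bipartiteAbove_eq_sum_card_bipartiteBelow
      (fun col u => (H col).Reachable v u)
  have hsumM : k * (Fintype.card V - 1) + (N.card - Y.card) ≤
      ∑ u ∈ Finset.univ.erase v, (M u).card := by
    have hNe : N \ Y ⊆ Finset.univ.erase v := fun x hx =>
      Finset.mem_erase.2 ⟨(hNadj x (Finset.mem_sdiff.1 hx).1).ne', Finset.mem_univ x⟩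
    have h1 : ∑ u ∈ Finset.univ.erase v, (k + if u ∈ N \ Y then 1 else 0) =
        k * (Fintype.card V - 1) + (N.card - Y.card) := by
      rw [Finset.sum_add_distrib, Finset.sum_const, Finset.card_erase_of_mem (Finset.mem_univ v),
        Finset.card_univ, smul_eq_mul, mul_comm, ← Finset.sum_filter, ← Finset.card_eq_sum_ones,
        Finset.filter_mem_eq_inter, Finset.inter_eq_right.2 hNe, Finset.card_sdiff_of_subset hYN]
    rw [← h1]
    refine Finset.sum_le_sum fun u hu => ?_
    have hku := hM u (Finset.ne_of_mem_erase hu)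
    split_ifs with h
    · have hne : (M u).card ≠ k := fun he => (Finset.mem_sdiff.1 h).2
        (Finset.mem_filter.2 ⟨(Finset.mem_sdiff.1 h).1, he⟩)
      omega
    · exact hku
  have htot := Finset.sum_le_sum hcol
  rw [Finset.sum_add_distrib, Finset.sum_add_distrib, hsumE, hsumA, hsumR] at htot
  have hAle := Finset.card_le_card hAC
  have hYle := Finset.card_le_card hYN
  have hmul : k * (Fintype.card V - 1) = k * (Fintype.card V - 2) + k := by
    rw [← Nat.mul_succ]
    congr 1
    omega
  rw [hcolors, hm]
  omega

/-- Coloring `k` edge-disjoint spanning trees monochromatically, and the remaining edges with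
private colors, gives an RMC-coloring with at least `m - k * (n - 2)` colors. -/
theorem SimpleGraph.TauGE.exists_isRMCColoring {V : Type*} [Fintype V] {G : SimpleGraph V} {k : ℕ}
    (htau : G.TauGE k) (hn : 2 ≤ Fintype.card V) :
    ∃ c, G.IsRMCColoring k c ∧
      G.edgeSet.ncard ≤ G.colorsUsed c + k * (Fintype.card V - 2) := by
  classical
  obtain ⟨T, hTG, hT, hdisj⟩ := htau
  obtain ⟨f, hf⟩ := exists_injective_nat (Sym2 V)
  let c : Sym2 V → ℕ := fun e => if h : ∃ i, e ∈ (T i).edgeSet then (h.choose : ℕ) else k + f e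
  have hcT : ∀ i, ∀ e ∈ (T i).edgeSet, c e = i := by
    intro i e he
    have h : ∃ i, e ∈ (T i).edgeSet := ⟨i, he⟩
    simp only [c, dif_pos h]
    by_contra hne
    exact Set.disjoint_left.1 (hdisj _ i fun h' => hne (congrArg Fin.val h')) h.choose_spec he
  refine ⟨c, ?_, ?_⟩
  · intro u v _
    choose P hP using fun i => ((hT i).connected.preconnected u v).exists_isPath
    have hmem : ∀ i, ∀ e ∈ ((P i).mapLe (hTG i)).edges, e ∈ (T i).edgeSet := by
      intro i e he
      rw [SimpleGraph.Walk.edges_mapLe_eq_edges] at he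
      exact (P i).edges_subset_edgeSet he
    refine ⟨fun i => (P i).mapLe (hTG i), fun i => i, fun i => (hP i).mapLe (hTG i),
      fun i e he => hcT i e (hmem i e he), fun i j hij e hi hj => ?_, Fin.val_injective⟩
    exact Set.disjoint_left.1 (hdisj i j hij) (hmem i e hi) (hmem j e hj)
  · let U : Finset (Sym2 V) := Finset.univ.biUnion fun i => (T i).edgeFinset
    let Q := G.edgeFinset \ U
    have hU : U.card ≤ k * (Fintype.card V - 1) := by
      refine Finset.card_biUnion_le.trans (le_of_eq ?_)
      rw [Finset.sum_congr rfl fun i _ => (Nat.eq_sub_of_add_eq (hT i).card_edgeFinset)]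
      simp
    have hm : G.edgeSet.ncard = G.edgeFinset.card := by
      rw [← SimpleGraph.coe_edgeFinset, Set.ncard_coe_finset]
    have hmQ : G.edgeFinset.card ≤ U.card + Q.card := by
      rw [add_comm]; exact Finset.card_le_card_sdiff_add_card
    have hcQ : ∀ e ∈ Q, c e = k + f e := by
      intro e he
      refine dif_neg ?_
      rintro ⟨i, hi⟩
      exact (Finset.mem_sdiff.1 he).2 (Finset.mem_biUnion.2
        ⟨i, Finset.mem_univ i, SimpleGraph.mem_edgeFinset.2 hi⟩)
    have hcolors : G.colorsUsed c = (G.edgeFinset.image c).card := by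
      rw [SimpleGraph.colorsUsed, ← SimpleGraph.coe_edgeFinset, ← Finset.coe_image,
        Set.ncard_coe_finset]
    have hsub : Finset.range k ∪ Q.image (fun e => k + f e) ⊆ G.edgeFinset.image c := by
      intro a ha
      rcases Finset.mem_union.1 ha with ha | ha
      · let i : Fin k := ⟨a, Finset.mem_range.1 ha⟩
        have hpos : 0 < (T i).edgeFinset.card := by
          have := (hT i).card_edgeFinset
          omega
        obtain ⟨e, he⟩ := Finset.card_pos.1 hpos
        rw [SimpleGraph.mem_edgeFinset] at he
        exact Finset.mem_image.2 ⟨e, SimpleGraph.mem_edgeFinset.2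
          (SimpleGraph.edgeSet_mono (hTG i) he), hcT i e he⟩
      · obtain ⟨e, he, rfl⟩ := Finset.mem_image.1 ha
        exact Finset.mem_image.2 ⟨e, (Finset.mem_sdiff.1 he).1, hcQ e he⟩
    have hcard := Finset.card_le_card hsub
    rw [Finset.card_union_of_disjoint (Finset.disjoint_left.2 fun a ha hb => by
        obtain ⟨e, _, rfl⟩ := Finset.mem_image.1 hb
        have := Finset.mem_range.1 ha
        omega), Finset.card_range,
      Finset.card_image_of_injective Q (f := fun e => k + f e)
        ((add_right_injective k).comp hf)] at hcard
    have hmul : k * (Fintype.card V - 1) = k * (Fintype.card V - 2) + k := by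
      rw [← Nat.mul_succ]
      congr 1
      omega
    rw [hcolors, hm]
    omega

/-- If `G` is triangle-free and `τ(G) ≥ k`, then `rmc_k(G) = m - k(n-2)`. -/
theorem rmc_eq_of_cliqueFree {V : Type*} [Fintype V] (G : SimpleGraph V) (k : ℕ)
    (hk : 1 ≤ k) (htri : G.CliqueFree 3) (htau : G.TauGE k) :
    G.rmc k = G.edgeSet.ncard - k * (Fintype.card V - 2) := by
  obtain ⟨v⟩ : Nonempty V := by
    obtain ⟨T, -, hT, -⟩ := htau
    exact (hT ⟨0, hk⟩).connected.nonempty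
  by_cases hn : 2 ≤ Fintype.card V
  · obtain ⟨c, hc, hcard⟩ := htau.exists_isRMCColoring hn
    have hup : ∀ t ∈ {t | ∃ c : Sym2 V → ℕ, G.IsRMCColoring k c ∧ G.colorsUsed c = t},
        t ≤ G.edgeSet.ncard - k * (Fintype.card V - 2) := by
      rintro t ⟨c, hc, rfl⟩
      have := hc.colorsUsed_add_le hk htri v hn
      omega
    refine le_antisymm (csSup_le ⟨_, c, hc, rfl⟩ hup) ?_
    refine le_trans (by omega) (le_csSup ⟨_, hup⟩ ⟨c, hc, rfl⟩)
  · have : Subsingleton V := Fintype.card_le_one_iff_subsingleton.1 (by omega)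
    obtain rfl := Subsingleton.elim G ⊥
    simp [SimpleGraph.rmc, SimpleGraph.colorsUsed, SimpleGraph.IsRMCColoring]
end

section
/- Let G be a simple graph on n vertices with m edges, and let k be a positive integer with τ(G) ≥ k. If the diameter of G is at least 3, then rmc_k(G) = m − k(n − 2). -/
open SimpleGraph

namespace SimpleGraph

open Finset

variable {V : Type*}

/-- A graph has at least as many edges as any set of vertices each of which is reachable
from outside the set. -/
lemma card_le_ncard_edgeSet_of_reachable [Fintype V] (H : SimpleGraph V) (D : Finset V)
    (hD : ∀ w ∈ D, ∃ r ∉ D, H.Reachable r w) : #D ≤ H.edgeSet.ncard := by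
  classical
  obtain rfl | ⟨w₀, hw₀⟩ := D.eq_empty_or_nonempty
  · simp
  obtain ⟨r₀, hr₀, -⟩ := hD w₀ hw₀
  let F : Finset (Sym2 V) := (Dᶜ.erase r₀).image fun r ↦ s(r₀, r)
  let K : SimpleGraph V := H ⊔ fromEdgeSet F
  have hroot : ∀ r ∉ D, K.Reachable r₀ r := fun r hr ↦ by
    obtain rfl | hne := eq_or_ne r r₀
    · exact .rfl
    · refine Adj.reachable (Or.inr ?_)
      rw [fromEdgeSet_adj]
      exact ⟨mem_image_of_mem _ (by simp [hne, hr]), hne.symm⟩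
  have hall : ∀ w, K.Reachable r₀ w := fun w ↦ by
    by_cases hw : w ∈ D
    · obtain ⟨r, hr, hrw⟩ := hD w hw
      exact (hroot r hr).trans (hrw.mono le_sup_left)
    · exact hroot w hw
  have hK : K.Connected :=
    { preconnected := fun a b ↦ (hall a).symm.trans (hall b), nonempty := ⟨r₀⟩ }
  have hsub : K.edgeSet ⊆ H.edgeSet ∪ F := by
    rw [edgeSet_sup, edgeSet_fromEdgeSet]
    exact Set.union_subset_union_right _ Set.sdiff_subset
  have hcard := hK.card_vert_le_card_edgeSet_add_one
  rw [Nat.card_eq_fintype_card, Nat.card_coe_set_eq] at hcard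
  have hle := (Set.ncard_le_ncard hsub).trans (Set.ncard_union_le _ _)
  rw [Set.ncard_coe_finset] at hle
  have hF : #F ≤ #(Dᶜ.erase r₀) := card_image_le
  have hr₀' : r₀ ∈ Dᶜ := by simpa using hr₀
  rw [card_erase_of_mem hr₀'] at hF
  have hpos := card_pos.2 ⟨r₀, hr₀'⟩
  have hcompl := card_add_card_compl D
  lia

/-- If every vertex of a set `S` avoiding `u` and `v` is connected, but not adjacent, to `u`
or to `v`, then a graph with at least one edge has more than `#S` edges. -/
lemma card_lt_ncard_edgeSet [Fintype V] (H : SimpleGraph V) {u v : V} (huv : u ≠ v)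
    (S : Finset V) (hu : u ∉ S) (hv : v ∉ S) (hE : H.edgeSet.Nonempty)
    (hS : ∀ w ∈ S, (¬H.Adj u w ∧ H.Reachable u w) ∨ (¬H.Adj v w ∧ H.Reachable v w)) :
    #S < H.edgeSet.ncard := by
  classical
  by_cases hr : H.Reachable u v
  · have hD := H.card_le_ncard_edgeSet_of_reachable (insert v S) fun w hw ↦ by
      refine ⟨u, by simp [huv, hu], ?_⟩
      obtain rfl | hw := mem_insert.1 hw
      · exact hr
      · exact (hS w hw).elim And.right fun h ↦ hr.trans h.2
    rwa [card_insert_of_notMem hv] at hD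
  obtain rfl | ⟨w, hw⟩ := S.eq_empty_or_nonempty
  · simpa only [card_empty] using (Set.ncard_pos).2 hE
  wlog h : ¬H.Adj u w ∧ H.Reachable u w generalizing u v
  · exact this huv.symm hv hu (fun w hw ↦ (hS w hw).symm) (fun h ↦ hr h.symm)
      ((hS w hw).resolve_left h)
  have huw : u ≠ w := fun h ↦ hu (h ▸ hw)
  obtain ⟨p⟩ := h.2
  obtain ⟨x, hux⟩ : ∃ x, H.Adj u x := by
    cases p with
    | nil => exact absurd rfl huw
    | cons h _ => exact ⟨_, h⟩
  have hxS : x ∉ S := fun hx ↦ (hS x hx).elim (fun h ↦ h.1 hux)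
    fun h ↦ hr (hux.reachable.trans h.2.symm)
  have hxv : v ≠ x := fun h ↦ hr (h ▸ hux.reachable)
  have hD := H.card_le_ncard_edgeSet_of_reachable (insert x S) fun y hy ↦ by
    obtain rfl | hy := mem_insert.1 hy
    · exact ⟨u, by simp [hux.ne, hu], hux.reachable⟩
    · obtain h | h := hS y hy
      · exact ⟨u, by simp [hux.ne, hu], h.2⟩
      · exact ⟨v, by simp [hxv, hv], h.2⟩
  rwa [card_insert_of_notMem hxS] at hD

/-- The spanning subgraph of the edges of color `j`. -/
def colorClass_s11 (G : SimpleGraph V) (c : Sym2 V → ℕ) (j : ℕ) : SimpleGraph V :=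
  fromEdgeSet {e ∈ G.edgeSet | c e = j}

lemma edgeSet_colorClass (G : SimpleGraph V) (c : Sym2 V → ℕ) (j : ℕ) :
    (G.colorClass_s11 c j).edgeSet = {e ∈ G.edgeSet | c e = j} := by
  rw [colorClass_s11, edgeSet_fromEdgeSet, sdiff_eq_left, Set.disjoint_left]
  exact fun e he ↦ G.not_isDiag_of_mem_edgeSet he.1

lemma colorClass_le (G : SimpleGraph V) (c : Sym2 V → ℕ) (j : ℕ) : G.colorClass_s11 c j ≤ G := by
  rw [← edgeSet_subset_edgeSet, edgeSet_colorClass]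
  exact Set.sep_subset _ _

lemma Walk.IsMonochromatic.reachable_s11 {G : SimpleGraph V} {c : Sym2 V → ℕ} {j : ℕ} {u v : V}
    {W : G.Walk u v} (hW : W.IsMonochromatic c j) : (G.colorClass_s11 c j).Reachable u v :=
  ⟨W.transfer _ fun e he ↦ by
    rw [edgeSet_colorClass]
    exact ⟨W.edges_subset_edgeSet he, hW e he⟩⟩

/-- In an RMC_k-coloring, any two vertices are connected in at least `k` color classes. -/
lemma IsRMCColoring.exists_finset {G : SimpleGraph V} {k : ℕ} {c : Sym2 V → ℕ}
    (hc : G.IsRMCColoring k c) {u v : V} (huv : u ≠ v) :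
    ∃ A : Finset ℕ, #A = k ∧ ∀ j ∈ A, (G.colorClass_s11 c j).Reachable u v := by
  obtain ⟨P, col, -, hmono, -, hinj⟩ := hc u v huv
  refine ⟨univ.map ⟨col, hinj⟩, by simp, fun j hj ↦ ?_⟩
  obtain ⟨i, -, rfl⟩ := mem_map.1 hj
  exact (hmono i).reachable_s11

lemma edgeSet_nonempty_of_reachable {H : SimpleGraph V} {u v : V} (h : H.Reachable u v)
    (huv : u ≠ v) : H.edgeSet.Nonempty := by
  obtain ⟨p⟩ := h
  cases p with
  | nil => exact absurd rfl huv
  | cons h _ => exact ⟨s(_, _), h⟩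

/-- If `u` and `v` have no common neighbor, an RMC_k-coloring wastes at least `k(n-2)` colors. -/
lemma IsRMCColoring.colorsUsed_add_le_s11 [Fintype V] {G : SimpleGraph V} {k : ℕ}
    {c : Sym2 V → ℕ} (hc : G.IsRMCColoring k c) {u v : V} (huv : u ≠ v)
    (hnb : ∀ w, ¬(G.Adj u w ∧ G.Adj v w)) :
    G.colorsUsed c + k * (Fintype.card V - 2) ≤ G.edgeSet.ncard := by
  classical
  let X : Finset V := univ \ {u, v}
  have hX : #X = Fintype.card V - 2 := by
    rw [card_sdiff_of_subset (subset_univ _), card_pair huv, card_univ]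
  have hA : ∀ w, ∃ A : Finset ℕ, w ∈ X → #A = k ∧ ∀ j ∈ A,
      (¬G.Adj u w ∧ (G.colorClass_s11 c j).Reachable u w) ∨
        (¬G.Adj v w ∧ (G.colorClass_s11 c j).Reachable v w) := fun w ↦ by
    by_cases hw : w ∈ X
    · have hw' : w ≠ u ∧ w ≠ v := by simpa [X] using hw
      by_cases huw : G.Adj u w
      · obtain ⟨A, hA, hAr⟩ := hc.exists_finset hw'.2.symm
        exact ⟨A, fun _ ↦ ⟨hA, fun j hj ↦ .inr ⟨fun h ↦ hnb w ⟨huw, h⟩, hAr j hj⟩⟩⟩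
      · obtain ⟨A, hA, hAr⟩ := hc.exists_finset hw'.1.symm
        exact ⟨A, fun _ ↦ ⟨hA, fun j hj ↦ .inl ⟨huw, hAr j hj⟩⟩⟩
    · exact ⟨∅, fun h ↦ absurd h hw⟩
  choose A hA using hA
  let C : Finset ℕ := G.edgeFinset.image c
  have hC : G.colorsUsed c = #C := by
    rw [colorsUsed, ← Set.ncard_coe_finset, coe_image, coe_edgeFinset]
  have hne : ∀ j ∈ C, (G.colorClass_s11 c j).edgeSet.Nonempty := fun j hj ↦ by
    obtain ⟨e, he, rfl⟩ := mem_image.1 hj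
    rw [edgeSet_colorClass]
    exact ⟨e, mem_edgeFinset.1 he, rfl⟩
  have hAC : ∀ w ∈ X, ∀ j ∈ A w, j ∈ C := fun w hw j hj ↦ by
    have hw' : w ≠ u ∧ w ≠ v := by simpa [X] using hw
    obtain ⟨e, he⟩ : (G.colorClass_s11 c j).edgeSet.Nonempty :=
      (((hA w hw).2 j hj).elim (fun h ↦ edgeSet_nonempty_of_reachable h.2 hw'.1.symm)
        fun h ↦ edgeSet_nonempty_of_reachable h.2 hw'.2.symm)
    rw [edgeSet_colorClass] at he
    exact mem_image.2 ⟨e, mem_edgeFinset.2 he.1, he.2⟩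
  have hlt : ∀ j ∈ C, #{w ∈ X | j ∈ A w} + 1 ≤ #{e ∈ G.edgeFinset | c e = j} := fun j hj ↦ by
    have h := card_lt_ncard_edgeSet (G.colorClass_s11 c j) huv {w ∈ X | j ∈ A w} (by simp [X])
      (by simp [X]) (hne j hj) fun w hw ↦ by
        obtain ⟨hwX, hwj⟩ := mem_filter.1 hw
        exact ((hA w hwX).2 j hwj).imp (fun h ↦ ⟨fun h' ↦ h.1 (G.colorClass_le c j h'), h.2⟩)
          fun h ↦ ⟨fun h' ↦ h.1 (G.colorClass_le c j h'), h.2⟩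
    have hset : (G.colorClass_s11 c j).edgeSet = ({e ∈ G.edgeFinset | c e = j} : Finset _) := by
      rw [edgeSet_colorClass]
      ext
      simp
    rwa [hset, Set.ncard_coe_finset] at h
  have hdouble : ∑ j ∈ C, #{w ∈ X | j ∈ A w} = k * #X := by
    have h := sum_card_bipartiteAbove_eq_sum_card_bipartiteBelow (s := C) (t := X)
      fun j w ↦ j ∈ A w
    simp only [bipartiteAbove, bipartiteBelow] at h
    rw [h, mul_comm, ← smul_eq_mul, ← sum_const]
    refine sum_congr rfl fun w hw ↦ ?_
    rw [← (hA w hw).1]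
    congr 1
    ext j
    simpa using hAC w hw j
  rw [← coe_edgeFinset, Set.ncard_coe_finset,
    card_eq_sum_card_image c, ← hX, ← hdouble, hC, card_eq_sum_ones, ← sum_add_distrib]
  exact sum_le_sum fun j hj ↦ by rw [add_comm]; exact hlt j hj

/-- Coloring each of `k` disjoint spanning trees with one color and all remaining edges with
distinct new colors wastes only `k(n-2)` colors. -/
lemma TauGE.exists_isRMCColoring_s11 [Fintype V] [Nontrivial V] {G : SimpleGraph V} {k : ℕ}
    (h : G.TauGE k) : ∃ c : Sym2 V → ℕ, G.IsRMCColoring k c ∧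
      G.edgeSet.ncard ≤ G.colorsUsed c + k * (Fintype.card V - 2) := by
  classical
  obtain ⟨T, hTG, hT, hdisj⟩ := h
  let ν : Sym2 V → ℕ := fun e ↦ k + Fintype.equivFin (Sym2 V) e
  have hν : Function.Injective ν := fun e f hef ↦ by
    simpa [ν, Fin.val_inj] using hef
  let c : Sym2 V → ℕ := fun e ↦ if h : ∃ i, e ∈ (T i).edgeSet then (h.choose : ℕ) else ν e
  have hcT : ∀ i, ∀ e ∈ (T i).edgeSet, c e = i := fun i e he ↦ by
    have hex : ∃ i, e ∈ (T i).edgeSet := ⟨i, he⟩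
    have : hex.choose = i := by
      by_contra hne
      exact Set.disjoint_left.1 (hdisj _ _ hne) hex.choose_spec he
    simp only [c, dif_pos hex, this]
  have hcν : ∀ e, (¬∃ i, e ∈ (T i).edgeSet) → c e = ν e := fun e he ↦ dif_neg he
  refine ⟨c, fun u v _ ↦ ?_, ?_⟩
  · choose P hP using fun i ↦ (hT i).connected.exists_isPath u v
    refine ⟨fun i ↦ (P i).mapLe (hTG i), fun i ↦ i, fun i ↦ (hP i).mapLe _, fun i e he ↦ ?_,
      fun i j hij e hi hj ↦ ?_, Fin.val_injective⟩
    · rw [Walk.edges_mapLe_eq_edges] at he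
      exact hcT i e ((P i).edges_subset_edgeSet he)
    · rw [Walk.edges_mapLe_eq_edges] at hi hj
      exact Set.disjoint_left.1 (hdisj i j hij) ((P i).edges_subset_edgeSet hi)
        ((P j).edges_subset_edgeSet hj)
  · let U : Finset (Sym2 V) := univ.biUnion fun i ↦ (T i).edgeFinset
    have hU : ∀ e, e ∈ U ↔ ∃ i, e ∈ (T i).edgeSet := by simp [U]
    have hUG : U ⊆ G.edgeFinset := fun e he ↦ by
      obtain ⟨i, hi⟩ := (hU e).1 he
      exact mem_edgeFinset.2 (edgeSet_mono (hTG i) hi)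
    have hUcard : #U ≤ k * (Fintype.card V - 1) := by
      refine card_biUnion_le.trans_eq ?_
      have hi : ∀ i, #(T i).edgeFinset = Fintype.card V - 1 := fun i ↦ by
        rw [← (hT i).card_edgeFinset, Nat.add_sub_cancel]
      simp [hi]
    have hcol : range k ∪ (G.edgeFinset \ U).image ν ⊆ G.edgeFinset.image c := by
      refine union_subset (fun i hi ↦ ?_) fun j hj ↦ ?_
      · obtain ⟨x, y, hxy⟩ := exists_pair_ne V
        have hi := mem_range.1 hi
        obtain ⟨e, he⟩ := edgeSet_nonempty_of_reachable
          ((hT ⟨i, hi⟩).connected.preconnected x y) hxy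
        exact mem_image.2 ⟨e, mem_edgeFinset.2 (edgeSet_mono (hTG _) he), hcT ⟨i, hi⟩ e he⟩
      · obtain ⟨e, he, rfl⟩ := mem_image.1 hj
        obtain ⟨heG, heU⟩ := mem_sdiff.1 he
        exact mem_image.2 ⟨e, heG, hcν e (mt (hU e).2 heU)⟩
    have hdis : Disjoint (range k) ((G.edgeFinset \ U).image ν) := by
      refine Finset.disjoint_left.2 fun j hj hj' ↦ ?_
      obtain ⟨e, -, rfl⟩ := mem_image.1 hj'
      simp [ν] at hj
    have hle := card_le_card hcol
    rw [card_union_of_disjoint hdis, card_range, card_image_of_injective _ hν,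
      card_sdiff_of_subset hUG] at hle
    rw [colorsUsed, ← coe_edgeFinset, ← coe_image, Set.ncard_coe_finset, Set.ncard_coe_finset]
    have hn : Fintype.card V - 1 = Fintype.card V - 2 + 1 := by
      have := Fintype.one_lt_card (α := V)
      lia
    rw [hn, mul_add, mul_one] at hUcard
    have := card_le_card hUG
    lia

end SimpleGraph

/-- If `τ(G) ≥ k` and `diam(G) ≥ 3`, then `rmc_k(G) = m - k(n-2)`. -/
theorem rmc_eq_of_three_le_diam {V : Type*} [Fintype V] (G : SimpleGraph V) (k : ℕ)
    (hk : 1 ≤ k) (htau : G.TauGE k) (hdiam : 3 ≤ G.diam) :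
    G.rmc k = G.edgeSet.ncard - k * (Fintype.card V - 2) := by
  have : Nontrivial V := nontrivial_of_diam_ne_zero (G := G) (by lia)
  obtain ⟨u, v, hdist⟩ := G.exists_dist_eq_diam
  have huv : u ≠ v := by
    rintro rfl
    rw [dist_self] at hdist
    lia
  have hnb : ∀ w, ¬(G.Adj u w ∧ G.Adj v w) := fun w ⟨huw, hvw⟩ ↦ by
    have h := dist_le (Walk.cons huw (Walk.cons hvw.symm Walk.nil))
    simp only [Walk.length_cons, Walk.length_nil] at h
    lia
  have hub : G.edgeSet.ncard - k * (Fintype.card V - 2) ∈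
      upperBounds {t | ∃ c : Sym2 V → ℕ, G.IsRMCColoring k c ∧ G.colorsUsed c = t} := by
    rintro _ ⟨c, hc, rfl⟩
    have := hc.colorsUsed_add_le_s11 huv hnb
    lia
  obtain ⟨c, hc, hcard⟩ := htau.exists_isRMCColoring_s11
  refine IsGreatest.csSup_eq ⟨⟨c, hc, ?_⟩, hub⟩
  have := hc.colorsUsed_add_le_s11 huv hnb
  lia
end
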